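/- arXiv:1402.7192 — 2 statements merged into one kernel-verified Lean document; each statement's English description precedes it below -/
import Mathlib

section
/- Let 1 ≤ p < ∞, let f ∈ U_p(ℝ²), and for h > 0 set f_h(x,y) = h^{−2} ∫₀^h ∫₀^h f(x+u, y+v) du dv and g_h = f − f_h. Then there is a constant c depending only on p such that ess sup_{ℝ²} |g_h| ≤ c ∫₀^h t^{1/p − 1} [φ₁*(t) + φ₂*(t)] dt, where φ₁(y) = ‖f_y‖*_{Lip 1/p} and φ₂(x) = ‖f_x‖*_{Lip 1/p}. In particular, ess sup |g_h| → 0 as h → 0⁺. -/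
open MeasureTheory Set
open scoped ENNReal

noncomputable section

/-- Extended essential sup norm on ℝ. -/
def einf (φ : ℝ → ℝ) : ℝ≥0∞ := eLpNorm φ ⊤ volume

/-- Lipschitz `α` seminorm (extended real valued):
`sup_{h>0} h^{-α} ‖φ(·+h) - φ‖_∞`. -/
def lipSemiE (α : ℝ) (φ : ℝ → ℝ) : ℝ≥0∞ :=
  ⨆ h ∈ Ioi (0:ℝ), ENNReal.ofReal (h ^ (-α)) * einf (fun x => φ (x + h) - φ x)

/-- Real-valued Lipschitz `α` seminorm `‖φ‖*_{Lip α}`. -/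
def lipSemi (α : ℝ) (φ : ℝ → ℝ) : ℝ := (lipSemiE α φ).toReal

/-- `φ ∈ Lip α`: essentially bounded with finite Lipschitz `α` seminorm. -/
def MemLip (α : ℝ) (φ : ℝ → ℝ) : Prop := einf φ < ⊤ ∧ lipSemiE α φ < ⊤

/-- `‖φ‖_{Lip α} = ‖φ‖_∞ + ‖φ‖*_{Lip α}`. -/
def lipNorm (α : ℝ) (φ : ℝ → ℝ) : ℝ := (einf φ + lipSemiE α φ).toReal

/-- The class `S₀`: measurable functions with finite distribution function at every
positive level. -/
def S0 {X : Type*} [MeasureSpace X] (f : X → ℝ) : Prop :=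
  Measurable f ∧ ∀ s : ℝ, 0 < s → volume {x | s < |f x|} < ⊤

/-- The non-increasing rearrangement `f*`. -/
def rearr {X : Type*} [MeasureSpace X] (f : X → ℝ) (t : ℝ) : ℝ :=
  sInf {s : ℝ | 0 ≤ s ∧ volume {x | s < |f x|} ≤ ENNReal.ofReal t}

/-- `f**(t) = (1/t) ∫₀^t f*(u) du`. -/
def doubleStar {X : Type*} [MeasureSpace X] (f : X → ℝ) (t : ℝ) : ℝ :=
  (∫ u in Ioc (0:ℝ) t, rearr f u) / t

/-- Lorentz `L^{p,q}` norm. -/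
def lorentzNorm {X : Type*} [MeasureSpace X] (p q : ℝ) (f : X → ℝ) : ℝ :=
  (∫ t in Ioi (0:ℝ), (t ^ (1/p) * rearr f t) ^ q / t) ^ (1/q)

/-- Membership in the Lorentz space `L^{p,q}`. -/
def MemLorentz {X : Type*} [MeasureSpace X] (p q : ℝ) (f : X → ℝ) : Prop :=
  S0 f ∧ IntegrableOn (fun t => (t ^ (1/p) * rearr f t) ^ q / t) (Ioi (0:ℝ))

/-- The space `U_p(ℝ²)`: a.e. sections in `Lip (1/p)`, with `Lip (1/p)` norms of the
sections in `L^{p,1}(ℝ)`. -/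
def MemUp (p : ℝ) (f : ℝ × ℝ → ℝ) : Prop :=
  Measurable f ∧
  (∀ᵐ y : ℝ ∂volume, MemLip (1/p) (fun x => f (x, y))) ∧
  (∀ᵐ x : ℝ ∂volume, MemLip (1/p) (fun y => f (x, y))) ∧
  MemLorentz p 1 (fun y => lipNorm (1/p) (fun x => f (x, y))) ∧
  MemLorentz p 1 (fun x => lipNorm (1/p) (fun y => f (x, y)))

/-- The Steklov-type average `f_h`. -/
def avg (f : ℝ × ℝ → ℝ) (h : ℝ) (z : ℝ × ℝ) : ℝ :=
  (∫ u in Ioc (0:ℝ) h, ∫ v in Ioc (0:ℝ) h, f (z.1 + u, z.2 + v)) / h ^ 2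

/-! ### The non-increasing rearrangement -/

section Rearrangement

variable {X : Type*} [MeasureSpace X]

lemma rearr_nonneg (f : X → ℝ) (t : ℝ) : 0 ≤ rearr f t :=
  Real.sInf_nonneg fun _ hs => hs.1

/-- `f` exceeds some level only on a set of measure at most `t`, for every `t > 0`; this makes
the rearrangement of `f` an infimum over a nonempty set. -/
def HasRearr (f : X → ℝ) : Prop :=
  ∀ t : ℝ, 0 < t → ∃ s : ℝ, 0 ≤ s ∧ volume {x | s < |f x|} ≤ ENNReal.ofReal t

lemma S0.hasRearr {f : X → ℝ} (hf : S0 f) : HasRearr f := by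
  intro t ht
  have hanti : Antitone fun n : ℕ => {x | ((n : ℝ) + 1) < |f x|} := by
    intro m n hmn x hx
    have : (m : ℝ) ≤ n := by exact_mod_cast hmn
    simp only [mem_ofPred_eq] at hx ⊢
    linarith
  have hlim := tendsto_measure_iInter_atTop (μ := (volume : Measure X))
    (fun n : ℕ => (measurableSet_lt measurable_const hf.1.abs).nullMeasurableSet) hanti
    ⟨0, (hf.2 _ (by positivity)).ne⟩
  have hempty : (⋂ n : ℕ, {x | ((n : ℝ) + 1) < |f x|}) = ∅ := by
    refine eq_empty_of_forall_notMem fun x hx => ?_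
    obtain ⟨n, hn⟩ := exists_nat_gt |f x|
    have := mem_iInter.1 hx n
    simp only [mem_ofPred_eq] at this
    linarith
  rw [hempty, measure_empty] at hlim
  obtain ⟨n, hn⟩ := (hlim.eventually_lt_const (ENNReal.ofReal_pos.2 ht)).exists
  exact ⟨n + 1, by positivity, hn.le⟩

lemma HasRearr.mono_ae {f g : X → ℝ} (hg : HasRearr g) (h : ∀ᵐ x : X, |f x| ≤ |g x|) :
    HasRearr f := by
  intro t ht
  obtain ⟨s, hs, hst⟩ := hg t ht
  refine ⟨s, hs, (measure_mono_ae ?_).trans hst⟩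
  filter_upwards [h] with x hx hxs
  exact lt_of_lt_of_le hxs hx

lemma HasRearr.rearr_le_rearr {f g : X → ℝ} (hg : HasRearr g) (h : ∀ᵐ x : X, |f x| ≤ |g x|)
    {t : ℝ} (ht : 0 < t) : rearr f t ≤ rearr g t := by
  refine csInf_le_csInf ⟨0, fun s hs => hs.1⟩ (hg t ht) fun s hs => ⟨hs.1, ?_⟩
  refine (measure_mono_ae ?_).trans hs.2
  filter_upwards [h] with x hx hxs
  exact lt_of_lt_of_le hxs hx

lemma HasRearr.antitoneOn {f : X → ℝ} (hf : HasRearr f) : AntitoneOn (rearr f) (Ioi 0) := by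
  intro a ha b _ hab
  exact csInf_le_csInf ⟨0, fun s hs => hs.1⟩ (hf a ha) fun s hs =>
    ⟨hs.1, hs.2.trans (ENNReal.ofReal_le_ofReal hab)⟩

lemma HasRearr.measure_gt_le {f : X → ℝ} (hf : HasRearr f) {t : ℝ} (ht : 0 < t) :
    volume {x | rearr f t < |f x|} ≤ ENNReal.ofReal t := by
  have hU : {x | rearr f t < |f x|} = ⋃ n : ℕ, {x | rearr f t + 1 / ((n : ℝ) + 1) < |f x|} := by
    ext x
    simp only [mem_ofPred_eq, mem_iUnion]
    constructor
    · intro hx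
      obtain ⟨n, hn⟩ := exists_nat_one_div_lt (sub_pos.2 hx)
      exact ⟨n, by linarith⟩
    · rintro ⟨n, hn⟩
      have : 0 < 1 / ((n : ℝ) + 1) := by positivity
      linarith
  have hmono : Monotone fun n : ℕ => {x | rearr f t + 1 / ((n : ℝ) + 1) < |f x|} := by
    intro m n hmn x hx
    have : 1 / ((n : ℝ) + 1) ≤ 1 / ((m : ℝ) + 1) := by gcongr
    simp only [mem_ofPred_eq] at hx ⊢
    linarith
  rw [hU, hmono.measure_iUnion]
  refine iSup_le fun n => ?_
  obtain ⟨s, hs, hlt⟩ := exists_lt_of_csInf_lt (hf t ht)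
    (lt_add_of_pos_right (rearr f t) (show 0 < 1 / ((n : ℝ) + 1) by positivity))
  exact (measure_mono fun x (hx : _ < _) => hlt.trans hx).trans hs.2

lemma MemLorentz.integrableOn_rearr {p : ℝ} {f g : X → ℝ} (hg : MemLorentz p 1 g)
    (h : ∀ᵐ x : X, |f x| ≤ |g x|) :
    IntegrableOn (fun t => t ^ (1 / p - 1) * rearr f t) (Ioi 0) := by
  have hg' := hg.1.hasRearr
  refine Integrable.mono' hg.2 ?_ ?_
  · refine AEMeasurable.aestronglyMeasurable (AEMeasurable.mul (by fun_prop) ?_)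
    exact aemeasurable_restrict_of_antitoneOn measurableSet_Ioi (hg'.mono_ae h).antitoneOn
  · refine (ae_restrict_iff' measurableSet_Ioi).2 (.of_forall fun t (ht : 0 < t) => ?_)
    have h0 := rearr_nonneg f t
    have h1 := hg'.rearr_le_rearr h ht
    rw [Real.norm_of_nonneg (by positivity), Real.rpow_one, Real.rpow_sub ht, Real.rpow_one,
      div_mul_eq_mul_div]
    gcongr

end Rearrangement

/-! ### Sections with a given Lipschitz bound -/

/-- The lines on which `g` has increments bounded by `M |x - t| ^ α` almost everywhere. -/
def lipSet (α : ℝ) (g : ℝ → ℝ → ℝ) (M : ℝ) : Set ℝ :=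
  {y | ∀ᵐ x : ℝ, ∀ᵐ x' : ℝ, |g x y - g x' y| ≤ M * |x - x'| ^ α}

lemma measurableSet_setOf_ae {X Y : Type*} [MeasurableSpace X] [MeasurableSpace Y]
    {ν : Measure Y} [SFinite ν] {P : X → Y → Prop}
    (hP : MeasurableSet {z : X × Y | P z.1 z.2}) : MeasurableSet {x | ∀ᵐ y ∂ν, P x y} :=
  measurable_measure_prodMk_left (ν := ν) hP.compl (measurableSet_singleton 0)

lemma measurableSet_lipSet_rel {g : ℝ → ℝ → ℝ} (hg : Measurable fun z : ℝ × ℝ => g z.1 z.2)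
    (α M : ℝ) : MeasurableSet {z : (ℝ × ℝ) × ℝ |
      |g z.1.2 z.1.1 - g z.2 z.1.1| ≤ M * |z.1.2 - z.2| ^ α} := by
  have h1 : Measurable fun z : (ℝ × ℝ) × ℝ => g z.1.2 z.1.1 :=
    hg.comp (f := fun z : (ℝ × ℝ) × ℝ => (z.1.2, z.1.1)) (by fun_prop)
  have h2 : Measurable fun z : (ℝ × ℝ) × ℝ => g z.2 z.1.1 :=
    hg.comp (f := fun z : (ℝ × ℝ) × ℝ => (z.2, z.1.1)) (by fun_prop)
  exact measurableSet_le (h1.sub h2).abs (by fun_prop)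

lemma measurableSet_lipSet {g : ℝ → ℝ → ℝ} (hg : Measurable fun z : ℝ × ℝ => g z.1 z.2)
    (α M : ℝ) : MeasurableSet (lipSet α g M) :=
  measurableSet_setOf_ae (measurableSet_setOf_ae (measurableSet_lipSet_rel hg α M))

lemma ae_ae_lipSet {g : ℝ → ℝ → ℝ} (hg : Measurable fun z : ℝ × ℝ => g z.1 z.2) (α M : ℝ) :
    ∀ᵐ s : ℝ, ∀ᵐ a : ℝ, ∀ᵐ t : ℝ, a ∈ lipSet α g M → |g s a - g t a| ≤ M * |s - t| ^ α := by
  have hm : MeasurableSet {z : (ℝ × ℝ) × ℝ |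
      z.1.1 ∈ lipSet α g M → |g z.1.2 z.1.1 - g z.2 z.1.1| ≤ M * |z.1.2 - z.2| ^ α} :=
    (((measurableSet_lipSet hg α M).mem.comp (by fun_prop)).imp
      (measurableSet_lipSet_rel hg α M).mem).setOf
  refine (Measure.ae_ae_comm (measurableSet_setOf_ae hm)).1 (.of_forall fun a => ?_)
  by_cases ha : a ∈ lipSet α g M
  · filter_upwards [ha] with s hs
    filter_upwards [hs] with t ht _ using ht
  · exact .of_forall fun s => .of_forall fun t h => absurd h ha

/-- Two generic points of `ℝ²`, the first on a good horizontal line and the second on a good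
vertical line, can be compared through the corner joining them. -/
lemma ae_ae_abs_sub_le {f : ℝ × ℝ → ℝ} (hf : Measurable f) (α M N : ℝ) :
    ∀ᵐ w : ℝ × ℝ, ∀ᵐ w' : ℝ × ℝ, w.2 ∈ lipSet α (fun x y => f (x, y)) M →
      w'.1 ∈ lipSet α (fun y x => f (x, y)) N →
      |f w - f w'| ≤ M * |w.1 - w'.1| ^ α + N * |w.2 - w'.2| ^ α := by
  have hg1 : Measurable fun z : ℝ × ℝ => f (z.1, z.2) := hf
  have hg2 : Measurable fun z : ℝ × ℝ => f (z.2, z.1) := hf.comp measurable_swap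
  have hm1 : MeasurableSet {z : (ℝ × ℝ) × ℝ | z.1.2 ∈ lipSet α (fun x y => f (x, y)) M →
      |f (z.1.1, z.1.2) - f (z.2, z.1.2)| ≤ M * |z.1.1 - z.2| ^ α} := by
    have hA := measurableSet_lipSet (g := fun x y => f (x, y)) hg1 α M
    exact ((hA.mem.comp (by fun_prop)).imp
      ((measurableSet_lipSet_rel (g := fun x y => f (x, y)) hg1 α M).mem.comp
        (f := fun z : (ℝ × ℝ) × ℝ => ((z.1.2, z.1.1), z.2)) (by fun_prop))).setOf
  have h1 : ∀ᵐ w : ℝ × ℝ, ∀ᵐ t : ℝ, w.2 ∈ lipSet α (fun x y => f (x, y)) M →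
      |f (w.1, w.2) - f (t, w.2)| ≤ M * |w.1 - t| ^ α :=
    (Measure.ae_prod_iff_ae_ae (measurableSet_setOf_ae hm1)).2
      (ae_ae_lipSet (g := fun x y => f (x, y)) hg1 α M)
  have hm2 (v : ℝ) : MeasurableSet {z : ℝ × ℝ | z.1 ∈ lipSet α (fun y x => f (x, y)) N →
      |f (z.1, v) - f (z.1, z.2)| ≤ N * |v - z.2| ^ α} := by
    have hA := measurableSet_lipSet (g := fun y x => f (x, y)) hg2 α N
    exact ((hA.mem.comp (by fun_prop)).imp
      ((measurableSet_lipSet_rel (g := fun y x => f (x, y)) hg2 α N).mem.comp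
        (f := fun z : ℝ × ℝ => ((z.1, v), z.2)) (by fun_prop))).setOf
  have h2 : ∀ᵐ v : ℝ, ∀ᵐ w' : ℝ × ℝ, w'.1 ∈ lipSet α (fun y x => f (x, y)) N →
      |f (w'.1, v) - f (w'.1, w'.2)| ≤ N * |v - w'.2| ^ α := by
    filter_upwards [ae_ae_lipSet (g := fun y x => f (x, y)) hg2 α N] with v hv
    exact (Measure.ae_prod_iff_ae_ae (hm2 v)).2 hv
  filter_upwards [h1, Measure.quasiMeasurePreserving_snd.ae h2] with w hw1 hw2
  filter_upwards [Measure.quasiMeasurePreserving_fst.ae hw1, hw2] with w' hw1' hw2' hM hN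
  calc |f w - f w'| ≤ |f w - f (w'.1, w.2)| + |f (w'.1, w.2) - f w'| := abs_sub_le _ _ _
    _ ≤ _ := add_le_add (hw1' hM) (hw2' hN)

lemma ae_abs_sub_le_lipSemi {α : ℝ} {φ : ℝ → ℝ} (hφ : lipSemiE α φ < ⊤) (h : ℝ) :
    ∀ᵐ x : ℝ, |φ x - φ (x + h)| ≤ lipSemi α φ * |h| ^ α := by
  have key : ∀ h : ℝ, 0 < h → ∀ᵐ x : ℝ, |φ x - φ (x + h)| ≤ lipSemi α φ * h ^ α := by
    intro h hh
    have hsup : ENNReal.ofReal (h ^ (-α)) * einf (fun x => φ (x + h) - φ x) ≤ lipSemiE α φ :=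
      le_iSup₂ (f := fun h (_ : h ∈ Ioi (0 : ℝ)) =>
        ENNReal.ofReal (h ^ (-α)) * einf (fun x => φ (x + h) - φ x)) h hh
    filter_upwards [ae_le_eLpNormEssSup (f := fun x => φ (x + h) - φ x) (μ := volume)] with x hx
    rw [← eLpNorm_exponent_top] at hx
    have h1 : ENNReal.ofReal (h ^ (-α)) * ‖φ (x + h) - φ x‖ₑ ≤ lipSemiE α φ :=
      (mul_le_mul_right hx _).trans hsup
    have h2 := ENNReal.toReal_mono hφ.ne h1
    have hpos : 0 < h ^ α := Real.rpow_pos_of_pos hh α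
    rw [ENNReal.toReal_mul, ENNReal.toReal_ofReal (by positivity), toReal_enorm,
      Real.norm_eq_abs, abs_sub_comm, Real.rpow_neg hh.le, inv_mul_le_iff₀ hpos, mul_comm] at h2
    exact h2
  rcases lt_trichotomy h 0 with hh | rfl | hh
  · have := (measurePreserving_add_right volume h).quasiMeasurePreserving.ae (key (-h) (by linarith))
    filter_upwards [this] with x hx
    rw [abs_of_neg hh, abs_sub_comm]
    simpa using hx
  · refine .of_forall fun x => ?_
    simp only [add_zero, sub_self, abs_zero]
    exact mul_nonneg ENNReal.toReal_nonneg (Real.rpow_nonneg le_rfl _)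
  · simpa [abs_of_pos hh] using key h hh

lemma mem_lipSet {α : ℝ} {g : ℝ → ℝ → ℝ} {y M : ℝ} (hg : Measurable fun x => g x y)
    (hy : lipSemiE α (fun x => g x y) < ⊤) (hM : lipSemi α (fun x => g x y) ≤ M) :
    y ∈ lipSet α g M := by
  have h1 : ∀ h : ℝ, ∀ᵐ x : ℝ, |g x y - g (x + h) y| ≤ M * |h| ^ α := fun h => by
    filter_upwards [ae_abs_sub_le_lipSemi hy h] with x hx
    exact hx.trans (by gcongr)
  have hm : MeasurableSet {z : ℝ × ℝ | |g z.2 y - g (z.2 + z.1) y| ≤ M * |z.1| ^ α} :=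
    measurableSet_le (by fun_prop) (by fun_prop)
  have h2 := (Measure.ae_ae_comm (μ := volume) (ν := volume) hm).1 (.of_forall h1)
  change ∀ᵐ x : ℝ, ∀ᵐ x' : ℝ, |g x y - g x' y| ≤ M * |x - x'| ^ α
  filter_upwards [h2] with x hx
  filter_upwards [(measurePreserving_add_right volume (-x)).quasiMeasurePreserving.ae hx] with x' hx'
  rw [abs_sub_comm x x']
  simpa [sub_eq_add_neg] using hx'

lemma measure_compl_lipSet_le {α : ℝ} {g : ℝ → ℝ → ℝ}
    (hg : Measurable fun z : ℝ × ℝ => g z.1 z.2)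
    (hfin : ∀ᵐ y : ℝ, lipSemiE α (fun x => g x y) < ⊤)
    (hr : HasRearr fun y => lipSemi α (fun x => g x y)) {t : ℝ} (ht : 0 < t) :
    volume (lipSet α g (rearr (fun y => lipSemi α (fun x => g x y)) t))ᶜ ≤ ENNReal.ofReal t := by
  refine (measure_mono_ae ?_).trans (hr.measure_gt_le ht)
  filter_upwards [hfin] with y hy hmem
  by_contra hle
  exact hmem (mem_lipSet (hg.comp measurable_prodMk_right) hy
    ((le_abs_self _).trans (not_lt.1 hle)))

/-! ### Good squares and density points -/

lemma ofReal_sub_le_volume_Icc_inter {A : Set ℝ} {a b τ : ℝ} (hτ : 0 ≤ τ)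
    (hA : volume Aᶜ ≤ ENNReal.ofReal τ) :
    ENNReal.ofReal (b - a - τ) ≤ volume (Icc a b ∩ A) := by
  rw [ENNReal.ofReal_sub _ hτ, tsub_le_iff_right, ← Real.volume_Icc]
  refine (measure_le_inter_add_sdiff volume (Icc a b) A).trans ?_
  gcongr
  exact (measure_mono fun x hx => hx.2).trans hA

lemma volume_closedBall_prod (z : ℝ × ℝ) {r : ℝ} (hr : 0 ≤ r) :
    volume (Metric.closedBall z r) = ENNReal.ofReal (4 * r ^ 2) := by
  rw [← closedBall_prod_same, Measure.volume_eq_prod, Measure.prod_prod, Real.volume_closedBall,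
    Real.volume_closedBall, ← ENNReal.ofReal_mul (by positivity)]
  ring_nf

lemma ofReal_le_volume_closedBall_inter_prod {A B : Set ℝ} {r : ℝ} (hr : 0 ≤ r)
    (hA : volume Aᶜ ≤ ENNReal.ofReal (r / 2)) (hB : volume Bᶜ ≤ ENNReal.ofReal (r / 2))
    (z : ℝ × ℝ) :
    ENNReal.ofReal (9 / 4 * r ^ 2) ≤ volume (Metric.closedBall z r ∩ A ×ˢ B) := by
  rw [← closedBall_prod_same, prod_inter_prod, Measure.volume_eq_prod, Measure.prod_prod,
    Real.closedBall_eq_Icc, Real.closedBall_eq_Icc]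
  have h1 := ofReal_sub_le_volume_Icc_inter (a := z.1 - r) (b := z.1 + r) (by positivity) hA
  have h2 := ofReal_sub_le_volume_Icc_inter (a := z.2 - r) (b := z.2 + r) (by positivity) hB
  refine le_trans (le_of_eq ?_) (mul_le_mul' h1 h2)
  rw [← ENNReal.ofReal_mul (by linarith)]
  ring_nf

lemma volume_closedBall_inter_closedBall_inter_prod_pos {A B : Set ℝ} {r : ℝ} (hr : 0 < r)
    (hA : volume Aᶜ ≤ ENNReal.ofReal (r / 2)) (hB : volume Bᶜ ≤ ENNReal.ofReal (r / 2))
    {z w : ℝ × ℝ} (hzw : dist z w ≤ r) :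
    0 < volume (Metric.closedBall z r ∩ Metric.closedBall w r ∩ A ×ˢ B) := by
  rw [← closedBall_prod_same, ← closedBall_prod_same, prod_inter_prod, prod_inter_prod,
    Measure.volume_eq_prod, Measure.prod_prod]
  rw [Prod.dist_eq, max_le_iff] at hzw
  have key : ∀ (a b : ℝ) (D : Set ℝ), dist a b ≤ r → volume Dᶜ ≤ ENNReal.ofReal (r / 2) →
      volume (Metric.closedBall a r ∩ Metric.closedBall b r ∩ D) ≠ 0 := by
    intro a b D hab hD
    have hab' := abs_le.1 (Real.dist_eq a b ▸ hab)
    rw [Real.closedBall_eq_Icc, Real.closedBall_eq_Icc, Icc_inter_Icc]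
    refine (lt_of_lt_of_le (ENNReal.ofReal_pos.2 ?_)
      (ofReal_sub_le_volume_Icc_inter (by positivity) hD)).ne'
    rcases le_total a b with h | h
    · rw [max_eq_right (by linarith), min_eq_left (by linarith)]; linarith
    · rw [max_eq_left (by linarith), min_eq_right (by linarith)]; linarith
  exact pos_iff_ne_zero.2 (mul_ne_zero (key _ _ _ hzw.1 hA) (key _ _ _ hzw.2 hB))

/-- Almost every point is a point of approximate continuity, quantitatively. -/
lemma ae_eventually_lt_volume_inter_closedBall {f : ℝ × ℝ → ℝ} (hf : Measurable f) :
    ∀ᵐ z : ℝ × ℝ, ∀ m : ℕ, ∀ᶠ r in nhdsWithin (0 : ℝ) (Ioi 0),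
      ENNReal.ofReal (2 * r ^ 2) <
        volume ({w | |f z - f w| ≤ 1 / ((m : ℝ) + 1)} ∩ Metric.closedBall z r) := by
  have hdens : ∀ᵐ z : ℝ × ℝ, ∀ (q : ℚ) (m : ℕ), |f z - q| < 1 / (2 * ((m : ℝ) + 1)) →
      Filter.Tendsto (fun r => volume ({w | |f w - q| < 1 / (2 * ((m : ℝ) + 1))} ∩
        Metric.closedBall z r) / volume (Metric.closedBall z r))
        (nhdsWithin 0 (Ioi 0)) (nhds 1) := by
    refine ae_all_iff.2 fun q => ae_all_iff.2 fun m => ?_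
    exact (ae_restrict_iff' (measurableSet_lt (hf.sub_const _).abs measurable_const)).1
      (Besicovitch.ae_tendsto_measure_inter_div volume
        {w : ℝ × ℝ | |f w - q| < 1 / (2 * ((m : ℝ) + 1))})
  filter_upwards [hdens] with z hz m
  have hε : 0 < 1 / (2 * ((m : ℝ) + 1)) := by positivity
  obtain ⟨q, hq1, hq2⟩ := exists_rat_btwn (show f z < f z + 1 / (2 * ((m : ℝ) + 1)) by linarith)
  have hq : |f z - q| < 1 / (2 * ((m : ℝ) + 1)) := abs_lt.2 ⟨by linarith, by linarith⟩
  have hhalf : ENNReal.ofReal (1 / 2) < 1 := by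
    rw [← ENNReal.ofReal_one, ENNReal.ofReal_lt_ofReal_iff one_pos]; norm_num
  filter_upwards [(hz q m hq).eventually_const_lt hhalf, self_mem_nhdsWithin] with r hr hr0
  have hr0' : 0 < r := hr0
  rw [volume_closedBall_prod z hr0'.le, ENNReal.lt_div_iff_mul_lt (by simp) (by simp),
    ← ENNReal.ofReal_mul (by norm_num)] at hr
  refine lt_of_lt_of_le (lt_of_eq_of_lt (by ring_nf) hr)
    (measure_mono (inter_subset_inter_left _ fun w hw => ?_))
  rw [mem_ofPred_eq] at hw ⊢
  have h1 := abs_sub_le (f z) q (f w)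
  rw [abs_sub_comm (q : ℝ)] at h1
  have h2 : 1 / (2 * ((m : ℝ) + 1)) + 1 / (2 * ((m : ℝ) + 1)) = 1 / ((m : ℝ) + 1) := by
    field_simp; norm_num
  linarith

/-! ### Chaining -/

lemma ae_ae_abs_sub_le_sum {X : Type*} [MeasurableSpace X] {μ : Measure X} {E : ℕ → Set X}
    (hE : ∀ k, μ (E k) ≠ 0) {g : X → ℝ} {b : ℕ → ℝ}
    (hstep : ∀ k, ∀ᵐ w ∂μ, ∀ᵐ w' ∂μ, w ∈ E (k + 1) → w' ∈ E k → |g w - g w'| ≤ b k) (n : ℕ) :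
    ∀ᵐ w ∂μ, w ∈ E (n + 1) → ∀ᵐ w' ∂μ, w' ∈ E 0 →
      |g w - g w'| ≤ ∑ k ∈ Finset.range (n + 1), b k := by
  induction n with
  | zero =>
    filter_upwards [hstep 0] with w hw hwE
    filter_upwards [hw] with w' hw' hwE'
    simpa using hw' hwE hwE'
  | succ n ih =>
    filter_upwards [hstep (n + 1)] with w hw hwE
    obtain ⟨w₁, hw₁E, hw₁, hw₁'⟩ :=
      ((frequently_ae_mem_iff.2 (hE (n + 1))).and_eventually (hw.and ih)).exists
    filter_upwards [hw₁' hw₁E] with w' hw' hwE'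
    rw [Finset.sum_range_succ]
    linarith [abs_sub_le (g w) (g w₁) (g w'), hw₁ hwE hw₁E, hw' hwE']

lemma ae_ae_abs_sub_le_of_sum_le {f : ℝ × ℝ → ℝ} (hf : Measurable f) {α h S : ℝ} (hα : 0 ≤ α)
    (hh : 0 < h) {M N : ℕ → ℝ} (hM0 : ∀ k, 0 ≤ M k) (hN0 : ∀ k, 0 ≤ N k)
    (hM : ∀ k, volume (lipSet α (fun x y => f (x, y)) (M k))ᶜ ≤ ENNReal.ofReal (h / 2 ^ k / 2))
    (hN : ∀ k, volume (lipSet α (fun y x => f (x, y)) (N k))ᶜ ≤ ENNReal.ofReal (h / 2 ^ k / 2))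
    (hS : ∀ n, ∑ k ∈ Finset.range n, (2 * (h / 2 ^ k)) ^ α * (M (k + 1) + N k) ≤ S) :
    ∀ᵐ z : ℝ × ℝ, ∀ᵐ w : ℝ × ℝ, w ∈ Metric.closedBall z h ∩
      lipSet α (fun y x => f (x, y)) (N 0) ×ˢ lipSet α (fun x y => f (x, y)) (M 0) →
      |f z - f w| ≤ S := by
  set A : ℕ → Set ℝ := fun k => lipSet α (fun y x => f (x, y)) (N k) with hA
  set B : ℕ → Set ℝ := fun k => lipSet α (fun x y => f (x, y)) (M k) with hB
  have hAm : ∀ k, MeasurableSet (A k) := fun k =>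
    measurableSet_lipSet (g := fun y x => f (x, y)) (hf.comp measurable_swap) α _
  have hBm : ∀ k, MeasurableSet (B k) := fun k =>
    measurableSet_lipSet (g := fun x y => f (x, y)) hf α _
  filter_upwards [ae_eventually_lt_volume_inter_closedBall hf] with z hz
  set E : ℕ → Set (ℝ × ℝ) := fun k => Metric.closedBall z (h / 2 ^ k) ∩ A k ×ˢ B k with hEdef
  have hr : ∀ k : ℕ, 0 < h / 2 ^ k := fun k => by positivity
  have hvol : ∀ k, ENNReal.ofReal (9 / 4 * (h / 2 ^ k) ^ 2) ≤ volume (E k) := fun k =>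
    ofReal_le_volume_closedBall_inter_prod (hr k).le (hN k) (hM k) z
  have hE0 : ∀ k, volume (E k) ≠ 0 := fun k =>
    (lt_of_lt_of_le (ENNReal.ofReal_pos.2 (by have := hr k; positivity)) (hvol k)).ne'
  have hstep : ∀ k, ∀ᵐ w : ℝ × ℝ, ∀ᵐ w' : ℝ × ℝ, w ∈ E (k + 1) → w' ∈ E k →
      |f w - f w'| ≤ (2 * (h / 2 ^ k)) ^ α * (M (k + 1) + N k) := by
    intro k
    filter_upwards [ae_ae_abs_sub_le hf α (M (k + 1)) (N k)] with w hw
    filter_upwards [hw] with w' hw' hwE hwE'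
    refine (hw' hwE.2.2 hwE'.2.1).trans ?_
    have hd : dist w w' ≤ 2 * (h / 2 ^ k) := by
      have h1 := Metric.mem_closedBall.1 hwE.1
      have h2 := Metric.mem_closedBall.1 hwE'.1
      have h3 : h / 2 ^ (k + 1) ≤ h / 2 ^ k := by
        rw [pow_succ, ← div_div]; linarith [hr k]
      linarith [dist_triangle_right w w' z]
    rw [Prod.dist_eq, max_le_iff, Real.dist_eq, Real.dist_eq] at hd
    have h1 := Real.rpow_le_rpow (abs_nonneg _) hd.1 hα
    have h2 := Real.rpow_le_rpow (abs_nonneg _) hd.2 hα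
    linarith [mul_le_mul_of_nonneg_left h1 (hM0 (k + 1)), mul_le_mul_of_nonneg_left h2 (hN0 k)]
  have hchain := ae_ae_abs_sub_le_sum hE0 hstep
  have happrox : ∀ m : ℕ, ∀ᵐ w : ℝ × ℝ, w ∈ E 0 → |f z - f w| ≤ 1 / ((m : ℝ) + 1) + S := by
    intro m
    have hlim : Filter.Tendsto (fun n : ℕ => h / 2 ^ (n + 1)) Filter.atTop
        (nhdsWithin 0 (Ioi 0)) := by
      refine tendsto_nhdsWithin_iff.2 ⟨?_, .of_forall fun n => hr (n + 1)⟩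
      have := (tendsto_pow_atTop_nhds_zero_of_lt_one (r := (1 / 2 : ℝ)) (by norm_num)
        (by norm_num)).const_mul h
      rw [mul_zero] at this
      refine (this.comp (Filter.tendsto_add_atTop_nat 1)).congr fun n => ?_
      simp [div_eq_mul_inv]
    obtain ⟨n, hn⟩ := (hlim.eventually (hz m)).exists
    set r := h / 2 ^ (n + 1) with hrdef
    set D := {w | |f z - f w| ≤ 1 / ((m : ℝ) + 1)} with hD
    have hint : volume ((D ∩ Metric.closedBall z r) ∩ E (n + 1)) ≠ 0 := by
      intro h0
      have hEm : MeasurableSet (E (n + 1)) :=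
        measurableSet_closedBall.inter ((hAm _).prod (hBm _))
      have hle : volume (D ∩ Metric.closedBall z r) + volume (E (n + 1)) ≤
          ENNReal.ofReal (4 * r ^ 2) := by
        rw [← volume_closedBall_prod z (hr _).le, ← measure_union₀ hEm.nullMeasurableSet h0]
        exact measure_mono (union_subset inter_subset_right inter_subset_left)
      have hge : ENNReal.ofReal (2 * r ^ 2) + ENNReal.ofReal (9 / 4 * r ^ 2) ≤
          ENNReal.ofReal (4 * r ^ 2) := (add_le_add hn.le (hvol (n + 1))).trans hle
      rw [← ENNReal.ofReal_add (by positivity) (by positivity),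
        ENNReal.ofReal_le_ofReal_iff (by positivity)] at hge
      nlinarith [hr (n + 1)]
    obtain ⟨w₁, ⟨⟨hw₁D, -⟩, hw₁E⟩, hw₁⟩ :=
      ((frequently_ae_mem_iff.2 hint).and_eventually (hchain n)).exists
    filter_upwards [hw₁ hw₁E] with w hw hwE
    linarith [abs_sub_le (f z) (f w₁) (f w), hw hwE, hS (n + 1), show |f z - f w₁| ≤ _ from hw₁D]
  filter_upwards [ae_all_iff.2 happrox] with w hw hwE
  have hwE0 : w ∈ E 0 := by simpa [hEdef] using hwE
  refine le_of_forall_pos_lt_add fun ε hε => ?_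
  obtain ⟨m, hm⟩ := exists_nat_one_div_lt hε
  linarith [hw m hwE0]

/-- The essential oscillation of `f` at scale `h`. -/
lemma ae_ae_abs_sub_le_of_dist_le {f : ℝ × ℝ → ℝ} (hf : Measurable f) {α h S : ℝ} (hα : 0 ≤ α)
    (hh : 0 < h) {M N : ℕ → ℝ} (hM0 : ∀ k, 0 ≤ M k) (hN0 : ∀ k, 0 ≤ N k)
    (hM : ∀ k, volume (lipSet α (fun x y => f (x, y)) (M k))ᶜ ≤ ENNReal.ofReal (h / 2 ^ k / 2))
    (hN : ∀ k, volume (lipSet α (fun y x => f (x, y)) (N k))ᶜ ≤ ENNReal.ofReal (h / 2 ^ k / 2))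
    (hS : ∀ n, ∑ k ∈ Finset.range n, (2 * (h / 2 ^ k)) ^ α * (M (k + 1) + N k) ≤ S) :
    ∀ᵐ z : ℝ × ℝ, ∀ᵐ w : ℝ × ℝ, dist z w ≤ h → |f z - f w| ≤ 2 * S := by
  have key := ae_ae_abs_sub_le_of_sum_le hf hα hh hM0 hN0 hM hN hS
  filter_upwards [key] with z hz
  filter_upwards [key] with w hw hzw
  have hpos := volume_closedBall_inter_closedBall_inter_prod_pos hh
    (by simpa using hN 0) (by simpa using hM 0) hzw
  obtain ⟨v, ⟨⟨hvz, hvw⟩, hv⟩, hv1, hv2⟩ :=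
    ((frequently_ae_mem_iff.2 hpos.ne').and_eventually (hz.and hw)).exists
  have h1 := hv1 ⟨hvz, hv⟩
  have h2 := hv2 ⟨hvw, hv⟩
  rw [abs_sub_comm] at h2
  linarith [abs_sub_le (f z) (f v) (f w)]

lemma abs_sub_avg_le {f : ℝ × ℝ → ℝ} (hf : Measurable f) {h C : ℝ} (hh : 0 < h) {z : ℝ × ℝ}
    (hz : ∀ᵐ w : ℝ × ℝ, dist z w ≤ h → |f z - f w| ≤ C) : |f z - avg f h z| ≤ C := by
  set ν : Measure (ℝ × ℝ) :=
    (volume.restrict (Ioc (0 : ℝ) h)).prod (volume.restrict (Ioc (0 : ℝ) h)) with hν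
  set F : ℝ × ℝ → ℝ := fun q => f (z.1 + q.1, z.2 + q.2) with hF
  have hνr : ν = (volume : Measure (ℝ × ℝ)).restrict (Ioc (0 : ℝ) h ×ˢ Ioc (0 : ℝ) h) := by
    rw [hν, Measure.prod_restrict, Measure.volume_eq_prod]
  have hFm : Measurable F := hf.comp (by fun_prop)
  have hbd : ∀ᵐ q ∂ν, ‖f z - F q‖ ≤ C := by
    rw [hνr, ae_restrict_iff' (measurableSet_Ioc.prod measurableSet_Ioc)]
    have hshift := measurePreserving_add_left (volume : Measure (ℝ × ℝ)) z
    filter_upwards [hshift.quasiMeasurePreserving.ae hz] with q hq hqm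
    refine hq ?_
    have h1 : |q.1| ≤ h := abs_le.2 ⟨by linarith [hqm.1.1], hqm.1.2⟩
    have h2 : |q.2| ≤ h := abs_le.2 ⟨by linarith [hqm.2.1], hqm.2.2⟩
    rw [dist_self_add_right]
    exact max_le h1 h2
  have hint : Integrable (fun q => f z - F q) ν :=
    Integrable.of_bound (by fun_prop) C hbd
  have hFint : Integrable F ν :=
    ((integrable_const (μ := ν) (f z)).sub hint).congr (.of_forall fun q => sub_sub_cancel _ _)
  have hvol : ν.real univ = h ^ 2 := by
    rw [hν, ← univ_prod_univ, measureReal_prod_prod]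
    simp [hh.le, pow_two]
  have havg : avg f h z = (∫ q, F q ∂ν) / h ^ 2 := by
    rw [avg, hν, integral_prod F hFint]
  have hsub : f z - avg f h z = (∫ q, (f z - F q) ∂ν) / h ^ 2 := by
    rw [havg, integral_sub (integrable_const _) hFint, integral_const, hvol, smul_eq_mul]
    field_simp
  have hle := norm_integral_le_of_norm_le_const hbd
  rw [hvol, Real.norm_eq_abs] at hle
  rw [hsub, abs_div, abs_of_pos (pow_pos hh 2), div_le_iff₀ (pow_pos hh 2)]
  exact hle

lemma sum_dyadic_le_integral {Φ : ℝ → ℝ} (hΦ : AntitoneOn Φ (Ioi 0)) (hΦ0 : ∀ t, 0 ≤ Φ t)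
    {α h : ℝ} (hα1 : α ≤ 1) (hh : 0 < h)
    (hint : IntegrableOn (fun t => t ^ (α - 1) * Φ t) (Ioi 0)) (n : ℕ) :
    ∑ k ∈ Finset.range n, (2 * (h / 2 ^ k)) ^ α * Φ (h / 2 ^ (k + 1) / 2) ≤
      16 * ∫ t in Ioc (0 : ℝ) h, t ^ (α - 1) * Φ t := by
  set G : ℝ → ℝ := fun t => t ^ (α - 1) * Φ t with hG
  set a : ℕ → ℝ := fun k => h / 2 ^ (k + 1) / 2 with ha
  have hapos : ∀ k, 0 < a k := fun k => by positivity
  have hasucc : ∀ k, a (k + 1) = a k / 2 := fun k => by simp only [ha, pow_succ]; field_simp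
  have hII : ∀ {x y : ℝ}, 0 < x → 0 < y → IntervalIntegrable G volume x y := by
    intro x y hx hy
    refine intervalIntegrable_iff.2 (hint.mono_set fun t ht => ?_)
    exact lt_of_lt_of_le (lt_min hx hy) ht.1.le
  have hstep : ∀ k, (2 * (h / 2 ^ k)) ^ α * Φ (a k) ≤ 16 * ∫ t in a (k + 1)..a k, G t := by
    intro k
    have hk := hapos k
    have hle : a (k + 1) ≤ a k := by rw [hasucc]; linarith
    have h1 : ∫ _ in a (k + 1)..a k, (a k) ^ (α - 1) * Φ (a k) ≤ ∫ t in a (k + 1)..a k, G t := by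
      refine intervalIntegral.integral_mono_on hle (by simp) (hII (hapos _) hk) fun t ht => ?_
      have ht0 : 0 < t := (hapos _).trans_le ht.1
      exact mul_le_mul (Real.rpow_le_rpow_of_nonpos ht0 ht.2 (by linarith))
        (hΦ ht0 hk ht.2) (hΦ0 _) (by positivity)
    rw [intervalIntegral.integral_const, smul_eq_mul, hasucc] at h1
    have h2 : 2 * (h / 2 ^ k) = 8 * a k := by simp only [ha, pow_succ]; field_simp; norm_num
    have h3 : (8 : ℝ) ^ α ≤ 8 := by
      simpa using Real.rpow_le_rpow_of_exponent_le (by norm_num : (1 : ℝ) ≤ 8) hα1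
    rw [h2, Real.mul_rpow (by norm_num) hk.le]
    have h4 : (a k) ^ α = a k * (a k) ^ (α - 1) := by
      rw [Real.rpow_sub hk, Real.rpow_one]; field_simp
    have h5 : 0 ≤ (a k) ^ α * Φ (a k) := mul_nonneg (by positivity) (hΦ0 _)
    calc 8 ^ α * (a k) ^ α * Φ (a k) = 8 ^ α * ((a k) ^ α * Φ (a k)) := by ring
      _ ≤ 8 * ((a k) ^ α * Φ (a k)) := mul_le_mul_of_nonneg_right h3 h5
      _ = 16 * ((a k - a k / 2) * ((a k) ^ (α - 1) * Φ (a k))) := by rw [h4]; ring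
      _ ≤ _ := by rw [hasucc]; linarith
  calc ∑ k ∈ Finset.range n, (2 * (h / 2 ^ k)) ^ α * Φ (a k)
      ≤ ∑ k ∈ Finset.range n, 16 * ∫ t in a (k + 1)..a k, G t :=
        Finset.sum_le_sum fun k _ => hstep k
    _ = 16 * ∫ t in a n..a 0, G t := by
        rw [← Finset.mul_sum, intervalIntegral.integral_symm (a 0) (a n),
          ← intervalIntegral.sum_integral_adjacent_intervals
            fun k _ => hII (hapos k) (hapos (k + 1)), ← Finset.sum_neg_distrib]
        simp_rw [← intervalIntegral.integral_symm]
    _ ≤ 16 * ∫ t in Ioc (0 : ℝ) h, G t := by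
        have hn0 : a n ≤ a 0 := by
          simp only [ha]
          gcongr
          · norm_num
          · omega
        rw [intervalIntegral.integral_of_le hn0]
        refine mul_le_mul_of_nonneg_left ?_ (by norm_num)
        refine setIntegral_mono_set (hint.mono_set Ioc_subset_Ioi_self) ?_
          (LE.le.eventuallyLE fun t ht => ⟨(hapos n).trans ht.1, ht.2.trans ?_⟩)
        · refine (ae_restrict_iff' measurableSet_Ioc).2 (.of_forall fun t ht => ?_)
          exact mul_nonneg (Real.rpow_nonneg ht.1.le _) (hΦ0 t)
        · simp only [ha, zero_add, pow_one]; linarith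

lemma lipSemi_le_lipNorm {α : ℝ} {φ : ℝ → ℝ} (hφ : MemLip α φ) :
    |lipSemi α φ| ≤ |lipNorm α φ| := by
  rw [lipSemi, lipNorm, abs_of_nonneg ENNReal.toReal_nonneg, abs_of_nonneg ENNReal.toReal_nonneg]
  exact ENNReal.toReal_mono (ENNReal.add_ne_top.2 ⟨hφ.1.ne, hφ.2.ne⟩) le_add_self

/-- If `1 ≤ p < ∞` and `f ∈ U_p(ℝ²)`, then with `g_h = f - f_h`,
`‖g_h‖_∞ ≤ c ∫₀^h t^{1/p-1} [φ₁*(t) + φ₂*(t)] dt` for all `h > 0` (with `c = c(p)`),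
and in particular `‖g_h‖_∞ → 0` as `h → 0⁺`. -/
theorem stmt10 (p : ℝ) (hp : 1 ≤ p) :
    ∃ c : ℝ, 0 < c ∧ ∀ f : ℝ × ℝ → ℝ, MemUp p f →
      (∀ h : ℝ, 0 < h →
        eLpNorm (fun z => f z - avg f h z) ⊤ volume ≤
          ENNReal.ofReal (c * ∫ t in Ioc (0:ℝ) h,
            t ^ (1/p - 1) *
              (rearr (fun y => lipSemi (1/p) (fun x => f (x, y))) t +
               rearr (fun x => lipSemi (1/p) (fun y => f (x, y))) t))) ∧
      Filter.Tendsto (fun h : ℝ => eLpNorm (fun z => f z - avg f h z) ⊤ volume)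
        (nhdsWithin 0 (Ioi 0)) (nhds 0) := by
  refine ⟨32, by norm_num, fun f hU => ?_⟩
  obtain ⟨hf, hL1, hL2, hN1, hN2⟩ := hU
  have hα0 : 0 ≤ 1 / p := by positivity
  have hα1 : 1 / p ≤ 1 := (div_le_one (by linarith)).2 hp
  set φ₁ : ℝ → ℝ := fun y => lipSemi (1 / p) (fun x => f (x, y)) with hφ₁
  set φ₂ : ℝ → ℝ := fun x => lipSemi (1 / p) (fun y => f (x, y)) with hφ₂
  have hle1 := hL1.mono fun y hy => lipSemi_le_lipNorm hy
  have hle2 := hL2.mono fun x hx => lipSemi_le_lipNorm hx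
  have hr1 : HasRearr φ₁ := hN1.1.hasRearr.mono_ae hle1
  have hr2 : HasRearr φ₂ := hN2.1.hasRearr.mono_ae hle2
  have hint : IntegrableOn (fun t => t ^ (1 / p - 1) * (rearr φ₁ t + rearr φ₂ t)) (Ioi 0) := by
    simp_rw [mul_add]
    exact (hN1.integrableOn_rearr hle1).add (hN2.integrableOn_rearr hle2)
  have hbound : ∀ h : ℝ, 0 < h → eLpNorm (fun z => f z - avg f h z) ⊤ volume ≤
      ENNReal.ofReal (32 * ∫ t in Ioc (0 : ℝ) h,
        t ^ (1 / p - 1) * (rearr φ₁ t + rearr φ₂ t)) := by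
    intro h hh
    have hsum := sum_dyadic_le_integral (hr1.antitoneOn.add hr2.antitoneOn)
      (fun t => add_nonneg (rearr_nonneg _ t) (rearr_nonneg _ t)) hα1 hh hint
    have hosc := ae_ae_abs_sub_le_of_dist_le hf hα0 hh
      (M := fun k => rearr φ₁ (h / 2 ^ k / 2)) (N := fun k => rearr φ₂ (h / 2 ^ k / 2))
      (fun k => rearr_nonneg _ _) (fun k => rearr_nonneg _ _)
      (fun k => measure_compl_lipSet_le (g := fun x y => f (x, y)) hf
        (hL1.mono fun y hy => hy.2) hr1 (by positivity))
      (fun k => measure_compl_lipSet_le (g := fun y x => f (x, y)) (hf.comp measurable_swap)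
        (hL2.mono fun x hx => hx.2) hr2 (by positivity))
      (fun n => (Finset.sum_le_sum fun k _ => by
        have : h / 2 ^ (k + 1) / 2 ≤ h / 2 ^ k / 2 := by
          gcongr
          · norm_num
          · omega
        exact mul_le_mul_of_nonneg_left (add_le_add_right (hr2.antitoneOn
          (show 0 < h / 2 ^ (k + 1) / 2 by positivity) (show 0 < h / 2 ^ k / 2 by positivity)
          this) _) (by positivity)).trans (hsum n))
    rw [eLpNorm_exponent_top]
    refine eLpNormEssSup_le_of_ae_bound ?_
    filter_upwards [hosc] with z hz
    refine (abs_sub_avg_le hf hh hz).trans (le_of_eq ?_)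
    ring
  refine ⟨hbound, ?_⟩
  have hprim : Filter.Tendsto (fun h : ℝ => ∫ t in Ioc (0 : ℝ) h,
      t ^ (1 / p - 1) * (rearr φ₁ t + rearr φ₂ t)) (nhdsWithin 0 (Ioi 0)) (nhds 0) := by
    have hcont := intervalIntegral.continuousOn_primitive (a := 0) (b := 1)
      ((integrableOn_Icc_iff_integrableOn_Ioc).2 (hint.mono_set Ioc_subset_Ioi_self))
    have h0 := hcont 0 (left_mem_Icc.2 zero_le_one)
    rw [ContinuousWithinAt, Ioc_self, setIntegral_empty] at h0
    refine h0.mono_left ?_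
    rw [← nhdsWithin_Ioc_eq_nhdsGT (zero_lt_one' ℝ)]
    exact nhdsWithin_mono _ Ioc_subset_Icc_self
  have hlim := ENNReal.tendsto_ofReal (hprim.const_mul 32)
  rw [mul_zero, ENNReal.ofReal_zero] at hlim
  refine tendsto_of_tendsto_of_tendsto_of_le_of_le' tendsto_const_nhds hlim
    (.of_forall fun h => zero_le) ?_
  filter_upwards [self_mem_nhdsWithin] with h hh using hbound h hh

end
end

section
/- Let φ ∈ L^∞(ℝ) ∩ S₀(ℝ). Then for every t > 0, ‖φ‖_∞ ≤ φ*(t) + 2 ω(φ; t), where ω(φ; t) = sup_{0 ≤ h ≤ t} ‖φ(·+h) − φ‖_∞ and ‖·‖_∞ denotes the essential supremum norm. -/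
open MeasureTheory Set
open scoped ENNReal

noncomputable section

/-- If the translates `φ(· + h)`, `0 ≤ h ≤ t`, differ from `φ` by at most `w` almost everywhere, and
`|φ|` exceeds `s` on a set of measure at most `t`, then `|φ| ≤ s + w` almost everywhere. -/
theorem ae_abs_le_add_of_translate_sub_le {φ : ℝ → ℝ} (hφ : Measurable φ) {s t w : ℝ} (ht : 0 < t)
    (hw : ∀ h ∈ Icc (0:ℝ) t, ∀ᵐ x : ℝ, |φ (x + h) - φ x| ≤ w)
    (hs : volume {x | s < |φ x|} ≤ ENNReal.ofReal t) :
    ∀ᵐ x : ℝ, |φ x| ≤ s + w := by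
  have hmeas : MeasurableSet {p : ℝ × ℝ | p.1 ∈ Icc (0:ℝ) t → |φ (p.2 + p.1) - φ p.2| ≤ w} := by
    have h₁ : MeasurableSet {p : ℝ × ℝ | p.1 ∈ Icc (0:ℝ) t} := measurable_fst measurableSet_Icc
    have h₂ : MeasurableSet {p : ℝ × ℝ | |φ (p.2 + p.1) - φ p.2| ≤ w} :=
      measurableSet_le (by fun_prop) measurable_const
    exact h₁.imp h₂
  have hgood : ∀ᵐ x : ℝ, ∀ᵐ h : ℝ, h ∈ Icc (0:ℝ) t → |φ (x + h) - φ x| ≤ w := by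
    refine (Measure.ae_ae_comm hmeas).1 (.of_forall fun h => ?_)
    by_cases hh : h ∈ Icc (0:ℝ) t
    · filter_upwards [hw h hh] with x hx _ using hx
    · exact .of_forall fun x hx => absurd hx hh
  have hfull : ∀ x, (∀ᵐ h : ℝ, h ∈ Icc (0:ℝ) t → |φ (x + h) - φ x| ≤ w) → s + w < |φ x| →
      ∀ᵐ y : ℝ, y ∈ Icc x (x + t) → s < |φ y| := by
    intro x hx hlt
    filter_upwards [(measurePreserving_sub_right volume x).quasiMeasurePreserving.ae hx]
      with y hy hmem
    have := hy ⟨by linarith [hmem.1], by linarith [hmem.2]⟩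
    rw [add_sub_cancel, abs_sub_comm] at this
    linarith [abs_sub_abs_le_abs_sub (φ x) (φ y)]
  have hsub : {x | (∀ᵐ h : ℝ, h ∈ Icc (0:ℝ) t → |φ (x + h) - φ x| ≤ w) ∧
      s + w < |φ x|}.Subsingleton := by
    have key : ∀ x y, x < y → (∀ᵐ z : ℝ, z ∈ Icc x (x + t) → s < |φ z|) →
        (∀ᵐ z : ℝ, z ∈ Icc y (y + t) → s < |φ z|) → False := by
      intro x y hxy hx hy
      have hle : volume (Icc x (x + t) ∪ Icc y (y + t)) ≤ volume {z | s < |φ z|} := by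
        refine measure_mono_ae ?_
        filter_upwards [hx, hy] with z hzx hzy hz
        exact hz.elim hzx hzy
      have hlen : ENNReal.ofReal (min t (y - x)) + ENNReal.ofReal t ≤
          volume (Icc x (x + t) ∪ Icc y (y + t)) := calc
        _ = volume (Ico x (x + min t (y - x)) ∪ Icc y (y + t)) := by
          rw [measure_union _ measurableSet_Icc, Real.volume_Ico, Real.volume_Icc,
            add_sub_cancel_left, add_sub_cancel_left]
          refine Set.disjoint_left.2 fun z hz hz' => ?_
          linarith [hz.2, hz'.1, min_le_right t (y - x)]
        _ ≤ _ := by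
          gcongr
          exact Ico_subset_Icc_self.trans (Icc_subset_Icc_right (by simp))
      have hδ : 0 < min t (y - x) := lt_min ht (sub_pos.2 hxy)
      have := hlen.trans (hle.trans hs)
      rw [← ENNReal.ofReal_add hδ.le ht.le, ENNReal.ofReal_le_ofReal_iff ht.le] at this
      linarith
    rintro x ⟨hx, hxs⟩ y ⟨hy, hys⟩
    by_contra hne
    rcases lt_or_gt_of_ne hne with h | h
    · exact key x y h (hfull x hx hxs) (hfull y hy hys)
    · exact key y x h (hfull y hy hys) (hfull x hx hxs)
  have hnull := hsub.measure_zero (volume : Measure ℝ)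
  filter_upwards [hgood, measure_eq_zero_iff_ae_notMem.1 hnull] with x hx hx'
  by_contra! hlt
  exact hx' ⟨hx, hlt⟩

/-- If `φ ∈ L^∞(ℝ) ∩ S₀(ℝ)`, then for every `t > 0`,
`‖φ‖_∞ ≤ φ*(t) + 2 ω(φ; t)`, where `ω(φ; t) = sup_{0 ≤ h ≤ t} ‖φ(·+h) - φ‖_∞`. -/
theorem stmt14 (φ : ℝ → ℝ) (hb : eLpNorm φ ⊤ volume < ⊤) (hS : S0 φ)
    (t : ℝ) (ht : 0 < t) :
    eLpNorm φ ⊤ volume ≤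
      ENNReal.ofReal (rearr φ t) +
        2 * ⨆ h ∈ Icc (0:ℝ) t, eLpNorm (fun x => φ (x + h) - φ x) ⊤ volume := by
  rcases eq_or_ne (⨆ h ∈ Icc (0:ℝ) t, eLpNorm (fun x => φ (x + h) - φ x) ⊤ volume) ⊤ with hω | hω
  · rw [hω, ENNReal.mul_top two_ne_zero, add_top]
    exact le_top
  set ω := ⨆ h ∈ Icc (0:ℝ) t, eLpNorm (fun x => φ (x + h) - φ x) ⊤ volume with hω_def
  have hw : ∀ h ∈ Icc (0:ℝ) t, ∀ᵐ x : ℝ, |φ (x + h) - φ x| ≤ ω.toReal := by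
    intro h hh
    have hle : eLpNormEssSup (fun x => φ (x + h) - φ x) volume ≤ ω := by
      rw [← eLpNorm_exponent_top]
      exact le_iSup₂ (f := fun h (_ : h ∈ Icc (0:ℝ) t) =>
        eLpNorm (fun x => φ (x + h) - φ x) ⊤ volume) h hh
    filter_upwards [enorm_ae_le_eLpNormEssSup (fun x => φ (x + h) - φ x) volume] with x hx
    have := ENNReal.toReal_mono hω (hx.trans hle)
    rwa [toReal_enorm, Real.norm_eq_abs] at this
  have hbound : (eLpNorm φ ⊤ volume).toReal - ω.toReal ≤ rearr φ t := by
    refine le_csInf ⟨(eLpNorm φ ⊤ volume).toReal, ENNReal.toReal_nonneg, ?_⟩ ?_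
    · have h0 : volume {x | (eLpNorm φ ⊤ volume).toReal < |φ x|} = 0 := by
        rw [measure_eq_zero_iff_ae_notMem]
        filter_upwards [enorm_ae_le_eLpNormEssSup φ volume] with x hx
        have := ENNReal.toReal_mono hb.ne (hx.trans_eq eLpNorm_exponent_top.symm)
        rw [toReal_enorm, Real.norm_eq_abs] at this
        simpa using this
      rw [h0]
      exact zero_le
    · rintro s ⟨hs0, hs⟩
      rw [sub_le_iff_le_add]
      refine ENNReal.toReal_le_of_le_ofReal (add_nonneg hs0 ENNReal.toReal_nonneg) ?_
      rw [eLpNorm_exponent_top]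
      exact eLpNormEssSup_le_of_ae_bound (ae_abs_le_add_of_translate_sub_le hS.1 ht hw hs)
  calc eLpNorm φ ⊤ volume = ENNReal.ofReal (eLpNorm φ ⊤ volume).toReal :=
        (ENNReal.ofReal_toReal hb.ne).symm
    _ ≤ ENNReal.ofReal (rearr φ t + ω.toReal) := ENNReal.ofReal_le_ofReal (by linarith)
    _ ≤ ENNReal.ofReal (rearr φ t) + ω := by
        simpa [ENNReal.ofReal_toReal hω] using
          ENNReal.ofReal_add_le (p := rearr φ t) (q := ω.toReal)
    _ ≤ ENNReal.ofReal (rearr φ t) + 2 * ω := by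
        gcongr
        exact le_mul_of_one_le_left zero_le one_le_two


end
end
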